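/- arXiv:2301.05283 — 6 statements merged into one kernel-verified Lean document; each statement's English description precedes it below -/
import Mathlib

section
/- Let K: ℝ⁶ → ℝ be a linear function such that every integral curve of the vector field sgrad K is periodic (for each initial point y the solution γ of γ' = sgrad K(γ), γ(0) = y satisfies γ(t+T) = γ(t) for all t, for some T > 0). Then there exist a rotation A ∈ SO(3), a vector v ∈ ℝ³ and a constant c ∈ ℝ such that the linear map Φ(S,R) = (A·S + v × (A·R), A·R) satisfies K(Φ(S,R)) = c·S₃ for all (S,R) ∈ ℝ⁶. -/
noncomputable section

/-- ℝ⁶ with coordinates (S₁,S₂,S₃,R₁,R₂,R₃). -/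
abbrev E6 := Fin 6 → ℝ

/-- Partial derivative of `f` at `y` in the `i`-th coordinate direction. -/
def pd (f : E6 → ℝ) (y : E6) (i : Fin 6) : ℝ := fderiv ℝ f y (Pi.single i 1)

/-- Cross product in ℝ³. -/
def cross (u v : Fin 3 → ℝ) : Fin 3 → ℝ :=
  ![u 1 * v 2 - u 2 * v 1, u 2 * v 0 - u 0 * v 2, u 0 * v 1 - u 1 * v 0]

/-- Euclidean inner product in ℝ³. -/
def dot (u v : Fin 3 → ℝ) : ℝ := u 0 * v 0 + u 1 * v 1 + u 2 * v 2

/-- Assemble a point of ℝ⁶ from S- and R-blocks. -/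
def pt (S R : Fin 3 → ℝ) : E6 := ![S 0, S 1, S 2, R 0, R 1, R 2]

/-- S-block of a point of ℝ⁶. -/
def Sv (y : E6) : Fin 3 → ℝ := ![y 0, y 1, y 2]

/-- R-block of a point of ℝ⁶. -/
def Rv (y : E6) : Fin 3 → ℝ := ![y 3, y 4, y 5]

/-- The Hamiltonian vector field (skew gradient)
`sgrad f = (∂f/∂S × S + ∂f/∂R × R, ∂f/∂S × R)`. -/
def sgrad (f : E6 → ℝ) (y : E6) : E6 :=
  pt (cross ![pd f y 0, pd f y 1, pd f y 2] (Sv y)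
        + cross ![pd f y 3, pd f y 4, pd f y 5] (Rv y))
     (cross ![pd f y 0, pd f y 1, pd f y 2] (Rv y))

/-- The Lie–Poisson bracket for e(3)*:
`{f,g}(S,R) = ⟨S, f_S × g_S⟩ + ⟨R, f_S × g_R⟩ + ⟨R, f_R × g_S⟩`. -/
def bracket (f g : E6 → ℝ) (y : E6) : ℝ :=
  dot (Sv y) (cross ![pd f y 0, pd f y 1, pd f y 2] ![pd g y 0, pd g y 1, pd g y 2])
  + dot (Rv y) (cross ![pd f y 0, pd f y 1, pd f y 2] ![pd g y 3, pd g y 4, pd g y 5])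
  + dot (Rv y) (cross ![pd f y 3, pd f y 4, pd f y 5] ![pd g y 0, pd g y 1, pd g y 2])

/-- The Hamiltonian of form (4). -/
def H4 (β : ℝ) (g₁ g₂ g₃ V : ℝ → ℝ → ℝ) (y : E6) : ℝ :=
  (1/2) * ((y 0)^2 + (y 1)^2 + (y 2)^2 / β)
  + g₁ ((y 3)^2 + (y 4)^2 + (y 5)^2) (y 5) * (y 0 * y 4 - y 1 * y 3)
  + g₂ ((y 3)^2 + (y 4)^2 + (y 5)^2) (y 5) * (y 0 * y 3 + y 1 * y 4 + y 2 * y 5)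
  + g₃ ((y 3)^2 + (y 4)^2 + (y 5)^2) (y 5) * y 2
  + V ((y 3)^2 + (y 4)^2 + (y 5)^2) (y 5)

/-- The reduced potential `W_{a,g}(k,x)`. -/
def W (β : ℝ) (g₁ g₂ g₃ V : ℝ → ℝ → ℝ) (a g k x : ℝ) : ℝ :=
  (g - k*x)^2 / (2*(a - x^2)) + k^2/(2*β) - (g₁ a x)^2 * (a - x^2)/2
  + g₂ a x * g + g₃ a x * k + V a x



lemma e3_frame (a0 a1 a2 : ℝ) (h : ¬ (a0 = 0 ∧ a1 = 0 ∧ a2 = 0)) :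
    ∃ n p0 p1 p2 : ℝ, 0 < n ∧ n ^ 2 = a0 ^ 2 + a1 ^ 2 + a2 ^ 2 ∧
      p0 ^ 2 + p1 ^ 2 + p2 ^ 2 = 1 ∧ a0 * p0 + a1 * p1 + a2 * p2 = 0 := by
  have hpos : 0 < a0 ^ 2 + a1 ^ 2 + a2 ^ 2 := by
    by_contra hc
    apply h
    refine ⟨?_, ?_, ?_⟩ <;> nlinarith [sq_nonneg a0, sq_nonneg a1, sq_nonneg a2]
  refine ⟨Real.sqrt (a0 ^ 2 + a1 ^ 2 + a2 ^ 2), ?_⟩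
  by_cases h1 : a0 ^ 2 + a1 ^ 2 = 0
  · refine ⟨1, 0, 0, Real.sqrt_pos.2 hpos, Real.sq_sqrt hpos.le, by norm_num, ?_⟩
    have : a0 = 0 := by nlinarith [sq_nonneg a0, sq_nonneg a1]
    simp [this]
  · have h2 : 0 < a0 ^ 2 + a1 ^ 2 := lt_of_le_of_ne (by positivity) (Ne.symm h1)
    have h3 := Real.sqrt_pos.2 h2
    have h4 := Real.sq_sqrt h2.le
    refine ⟨-a1 / Real.sqrt (a0 ^ 2 + a1 ^ 2), a0 / Real.sqrt (a0 ^ 2 + a1 ^ 2), 0,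
      Real.sqrt_pos.2 hpos, Real.sq_sqrt hpos.le, ?_, ?_⟩
    · rw [div_pow, div_pow, h4]; field_simp; ring
    · ring

lemma curve_deriv (n l q p r s t : ℝ) :
    HasDerivAt (fun t : ℝ => l * t * (n * (Real.cos (n * t) * q - Real.sin (n * t) * p))
        + (Real.cos (n * t) * r + Real.sin (n * t) * s))
      (l * (n * (Real.cos (n * t) * q - Real.sin (n * t) * p))
        + l * t * (n * (-(n * Real.sin (n * t)) * q - n * Real.cos (n * t) * p))
        + (-(n * Real.sin (n * t)) * r + n * Real.cos (n * t) * s)) t := by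
  have h0 : HasDerivAt (fun t : ℝ => n * t) n t := by
    simpa using (hasDerivAt_id t).const_mul n
  have hc := h0.cos
  have hs := h0.sin
  have hl : HasDerivAt (fun t : ℝ => l * t) l t := by
    simpa using (hasDerivAt_id t).const_mul l
  have := (hl.mul (((hc.mul_const q).sub (hs.mul_const p)).const_mul n)).add
    ((hc.mul_const r).add (hs.mul_const s))
  refine HasDerivAt.congr_deriv this ?_
  simp
  ring

lemma pd_lin (K : E6 →ₗ[ℝ] ℝ) (y : E6) (i : Fin 6) : pd (⇑K) y i = K (Pi.single i 1) := by
  unfold pd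
  have := (LinearMap.toContinuousLinearMap K).fderiv (x := y)
  have h2 : (⇑(LinearMap.toContinuousLinearMap K) : E6 → ℝ) = ⇑K := rfl
  rw [h2] at this
  rw [this]; rfl

lemma K_expand (K : E6 →ₗ[ℝ] ℝ) (y : E6) : K y = ∑ i, y i * K (Pi.single i 1) := by
  have := K.pi_apply_eq_sum_univ y
  rw [this]
  refine Finset.sum_congr rfl fun i _ => ?_
  rw [smul_eq_mul]
  congr 2
  ext j
  simp [Pi.single_apply, eq_comm]

/-- A linear function on e(3)* whose Hamiltonian flow is periodic
can be brought to the form `c·S₃` by a bracket-preserving linear change of variables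
`Φ(S,R) = (A·S + v × (A·R), A·R)` with `A ∈ SO(3)`. -/
theorem statement0 (K : E6 →ₗ[ℝ] ℝ)
    (hper : ∀ y : E6, ∀ γ : ℝ → E6, γ 0 = y →
      (∀ t : ℝ, HasDerivAt γ (sgrad (⇑K) (γ t)) t) →
      ∃ T > (0:ℝ), ∀ t : ℝ, γ (t + T) = γ t) :
    ∃ (A : Matrix (Fin 3) (Fin 3) ℝ) (v : Fin 3 → ℝ) (c : ℝ),
      A * A.transpose = 1 ∧ A.det = 1 ∧
      ∀ S R : Fin 3 → ℝ,
        K (pt (A.mulVec S + cross v (A.mulVec R)) (A.mulVec R)) = c * S 2 := by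
  obtain ⟨a0, ha0⟩ : ∃ x, x = K (Pi.single 0 1) := ⟨_, rfl⟩
  obtain ⟨a1, ha1⟩ : ∃ x, x = K (Pi.single 1 1) := ⟨_, rfl⟩
  obtain ⟨a2, ha2⟩ : ∃ x, x = K (Pi.single 2 1) := ⟨_, rfl⟩
  obtain ⟨b0, hb0⟩ : ∃ x, x = K (Pi.single 3 1) := ⟨_, rfl⟩
  obtain ⟨b1, hb1⟩ : ∃ x, x = K (Pi.single 4 1) := ⟨_, rfl⟩
  obtain ⟨b2, hb2⟩ : ∃ x, x = K (Pi.single 5 1) := ⟨_, rfl⟩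
  have hK : ∀ S R : Fin 3 → ℝ, K (pt S R) =
      a0 * S 0 + a1 * S 1 + a2 * S 2 + b0 * R 0 + b1 * R 1 + b2 * R 2 := by
    intro S R
    rw [K_expand, Fin.sum_univ_six, ← ha0, ← ha1, ← ha2, ← hb0, ← hb1, ← hb2]
    simp [pt]
    ring
  have hs : ∀ y, sgrad (⇑K) y = ![
      a1 * y 2 - a2 * y 1 + (b1 * y 5 - b2 * y 4),
      a2 * y 0 - a0 * y 2 + (b2 * y 3 - b0 * y 5),
      a0 * y 1 - a1 * y 0 + (b0 * y 4 - b1 * y 3),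
      a1 * y 5 - a2 * y 4, a2 * y 3 - a0 * y 5, a0 * y 4 - a1 * y 3] := by
    intro y
    unfold sgrad
    simp only [pd_lin, ← ha0, ← ha1, ← ha2, ← hb0, ← hb1, ← hb2]
    simp [pt, cross, Sv, Rv]
  clear ha0 ha1 ha2 hb0 hb1 hb2
  by_cases h : a0 = 0 ∧ a1 = 0 ∧ a2 = 0
  · obtain ⟨rfl, rfl, rfl⟩ := h
    have key : ∀ r0 r1 r2 : ℝ, b1 * r2 - b2 * r1 = 0 ∧ b2 * r0 - b0 * r2 = 0 ∧
        b0 * r1 - b1 * r0 = 0 := by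
      intro r0 r1 r2
      obtain ⟨T, hT, hp⟩ := hper _ (fun t => ![t * (b1 * r2 - b2 * r1), t * (b2 * r0 - b0 * r2),
        t * (b0 * r1 - b1 * r0), r0, r1, r2]) rfl (by
          intro t
          rw [hs, hasDerivAt_pi]
          intro i
          fin_cases i
          · simpa using (hasDerivAt_id t).mul_const (b1 * r2 - b2 * r1)
          · simpa using (hasDerivAt_id t).mul_const (b2 * r0 - b0 * r2)
          · simpa using (hasDerivAt_id t).mul_const (b0 * r1 - b1 * r0)
          · simpa using hasDerivAt_const t r0
          · simpa using hasDerivAt_const t r1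
          · simpa using hasDerivAt_const t r2)
      have h0 := hp 0
      have e0 := congrFun h0 0
      have e1 := congrFun h0 1
      have e2 := congrFun h0 2
      simp [hT.ne'] at e0 e1 e2
      exact ⟨e0, e1, e2⟩
    have k1 := key 1 0 0
    have k2 := key 0 1 0
    have z0 : b0 = 0 := by linarith [k2.2.2]
    have z1 : b1 = 0 := by linarith [k1.2.2]
    have z2 : b2 = 0 := by linarith [k1.2.1]
    refine ⟨1, 0, 0, by simp, by simp, ?_⟩
    intro S R
    rw [hK, z0, z1, z2]; ring
  · obtain ⟨n, p0, p1, p2, hn, hn2, hp, hap⟩ := e3_frame a0 a1 a2 h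
    have hn' := hn.ne'
    obtain ⟨u0, hu0⟩ : ∃ u, a0 = n * u := ⟨a0 / n, by field_simp⟩
    obtain ⟨u1, hu1⟩ : ∃ u, a1 = n * u := ⟨a1 / n, by field_simp⟩
    obtain ⟨u2, hu2⟩ : ∃ u, a2 = n * u := ⟨a2 / n, by field_simp⟩
    subst hu0 hu1 hu2
    have hu : u0 ^ 2 + u1 ^ 2 + u2 ^ 2 = 1 := by
      have : n ^ 2 * (u0 ^ 2 + u1 ^ 2 + u2 ^ 2) = n ^ 2 * 1 := by linarith
      exact mul_left_cancel₀ (by positivity) this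
    have hup : u0 * p0 + u1 * p1 + u2 * p2 = 0 := by
      have : n * (u0 * p0 + u1 * p1 + u2 * p2) = n * 0 := by linarith
      exact mul_left_cancel₀ hn' this
    clear hap hn2 h
    obtain ⟨q0, hq0⟩ : ∃ q, q = u1 * p2 - u2 * p1 := ⟨_, rfl⟩
    obtain ⟨q1, hq1⟩ : ∃ q, q = u2 * p0 - u0 * p2 := ⟨_, rfl⟩
    obtain ⟨q2, hq2⟩ : ∃ q, q = u0 * p1 - u1 * p0 := ⟨_, rfl⟩
    have hr0 : u1 * q2 - u2 * q1 = -p0 := by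
      subst hq1 hq2; linear_combination u0 * hup - p0 * hu
    have hr1 : u2 * q0 - u0 * q2 = -p1 := by
      subst hq0 hq2; linear_combination u1 * hup - p1 * hu
    have hr2 : u0 * q1 - u1 * q0 = -p2 := by
      subst hq0 hq1; linear_combination u2 * hup - p2 * hu
    obtain ⟨l, hl⟩ : ∃ l, l * n = u0 * b0 + u1 * b1 + u2 * b2 :=
      ⟨(u0 * b0 + u1 * b1 + u2 * b2) / n, by field_simp⟩
    obtain ⟨w0, hw0⟩ : ∃ w, n * w = u1 * b2 - u2 * b1 :=
      ⟨(u1 * b2 - u2 * b1) / n, by field_simp⟩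
    obtain ⟨w1, hw1⟩ : ∃ w, n * w = u2 * b0 - u0 * b2 :=
      ⟨(u2 * b0 - u0 * b2) / n, by field_simp⟩
    obtain ⟨w2, hw2⟩ : ∃ w, n * w = u0 * b1 - u1 * b0 :=
      ⟨(u0 * b1 - u1 * b0) / n, by field_simp⟩
    have c0 : b0 = l * n * u0 - n * (u1 * w2 - u2 * w1) := by
      linear_combination (-u0) * hl + u1 * hw2 - u2 * hw1 - b0 * hu
    have c1 : b1 = l * n * u1 - n * (u2 * w0 - u0 * w2) := by
      linear_combination (-u1) * hl + u2 * hw0 - u0 * hw2 - b1 * hu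
    have c2 : b2 = l * n * u2 - n * (u0 * w1 - u1 * w0) := by
      linear_combination (-u2) * hl + u0 * hw1 - u1 * hw0 - b2 * hu
    clear hl hw0 hw1 hw2
    have hl0 : l = 0 := by
      obtain ⟨T, hT, hpp⟩ := hper _ (fun t => ![
        l * t * (n * (Real.cos (n * t) * q0 - Real.sin (n * t) * p0))
          + (Real.cos (n * t) * (w1 * p2 - w2 * p1) + Real.sin (n * t) * (w1 * q2 - w2 * q1)),
        l * t * (n * (Real.cos (n * t) * q1 - Real.sin (n * t) * p1))
          + (Real.cos (n * t) * (w2 * p0 - w0 * p2) + Real.sin (n * t) * (w2 * q0 - w0 * q2)),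
        l * t * (n * (Real.cos (n * t) * q2 - Real.sin (n * t) * p2))
          + (Real.cos (n * t) * (w0 * p1 - w1 * p0) + Real.sin (n * t) * (w0 * q1 - w1 * q0)),
        0 * t * (n * (Real.cos (n * t) * 0 - Real.sin (n * t) * 0))
          + (Real.cos (n * t) * p0 + Real.sin (n * t) * q0),
        0 * t * (n * (Real.cos (n * t) * 0 - Real.sin (n * t) * 0))
          + (Real.cos (n * t) * p1 + Real.sin (n * t) * q1),
        0 * t * (n * (Real.cos (n * t) * 0 - Real.sin (n * t) * 0))
          + (Real.cos (n * t) * p2 + Real.sin (n * t) * q2)]) rfl (by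
          intro t
          rw [hs, hasDerivAt_pi]
          intro i
          fin_cases i
          · refine (curve_deriv n l q0 p0 _ _ t).congr_deriv ?_
            simp
            generalize Real.cos (n * t) = C
            generalize Real.sin (n * t) = D
            linear_combination l * t * n ^ 2 * (-C) * hr0 - l * t * n ^ 2 * D * hq0 - (C * p2 + D * q2) * c1 + (C * p1 + D * q1) * c2 + l * n * C * hq0 - l * n * D * hr0
              + n * w1 * (C * hq2 - D * hr2) - n * w2 * (C * hq1 - D * hr1)
          · refine (curve_deriv n l q1 p1 _ _ t).congr_deriv ?_
            simp
            generalize Real.cos (n * t) = C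
            generalize Real.sin (n * t) = D
            linear_combination l * t * n ^ 2 * (-C) * hr1 - l * t * n ^ 2 * D * hq1 - (C * p0 + D * q0) * c2 + (C * p2 + D * q2) * c0 + l * n * C * hq1 - l * n * D * hr1
              + n * w2 * (C * hq0 - D * hr0) - n * w0 * (C * hq2 - D * hr2)
          · refine (curve_deriv n l q2 p2 _ _ t).congr_deriv ?_
            simp
            generalize Real.cos (n * t) = C
            generalize Real.sin (n * t) = D
            linear_combination l * t * n ^ 2 * (-C) * hr2 - l * t * n ^ 2 * D * hq2 - (C * p1 + D * q1) * c0 + (C * p0 + D * q0) * c1 + l * n * C * hq2 - l * n * D * hr2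
              + n * w0 * (C * hq1 - D * hr1) - n * w1 * (C * hq0 - D * hr0)
          · refine (curve_deriv n 0 0 0 _ _ t).congr_deriv ?_
            simp
            linear_combination n * Real.cos (n * t) * hq0 - n * Real.sin (n * t) * hr0
          · refine (curve_deriv n 0 0 0 _ _ t).congr_deriv ?_
            simp
            linear_combination n * Real.cos (n * t) * hq1 - n * Real.sin (n * t) * hr1
          · refine (curve_deriv n 0 0 0 _ _ t).congr_deriv ?_
            simp
            linear_combination n * Real.cos (n * t) * hq2 - n * Real.sin (n * t) * hr2)
      have h0 := hpp 0
      have e0 := congrFun h0 0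
      have e1 := congrFun h0 1
      have e2 := congrFun h0 2
      have e3 := congrFun h0 3
      have e4 := congrFun h0 4
      have e5 := congrFun h0 5
      simp at e0 e1 e2 e3 e4 e5
      generalize Real.cos (n * T) = C at *
      generalize Real.sin (n * T) = D at *
      have f0 : l * T * n * (C * q0 - D * p0) = 0 := by
        linear_combination e0 - w1 * e5 + w2 * e4
      have f1 : l * T * n * (C * q1 - D * p1) = 0 := by
        linear_combination e1 - w2 * e3 + w0 * e5
      have f2 : l * T * n * (C * q2 - D * p2) = 0 := by
        linear_combination e2 - w0 * e4 + w1 * e3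
      have g0 : C * q0 - D * p0 = q0 := by
        linear_combination (C - 1) * hq0 - D * hr0 + u1 * e5 - u2 * e4
      have g1 : C * q1 - D * p1 = q1 := by
        linear_combination (C - 1) * hq1 - D * hr1 + u2 * e3 - u0 * e5
      have g2 : C * q2 - D * p2 = q2 := by
        linear_combination (C - 1) * hq2 - D * hr2 + u0 * e4 - u1 * e3
      rw [g0] at f0
      rw [g1] at f1
      rw [g2] at f2
      have hqq : p0 * (u2 * q1 - u1 * q2) + p1 * (u0 * q2 - u2 * q0)
          + p2 * (u1 * q0 - u0 * q1) = 1 := by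
        linear_combination hp - p0 * hr0 - p1 * hr1 - p2 * hr2
      have : l * (T * n) = 0 := by
        linear_combination (-(l * T * n)) * hqq + (p2 * u1 - p1 * u2) * f0
          + (p0 * u2 - p2 * u0) * f1 + (p1 * u0 - p0 * u1) * f2
      rcases mul_eq_zero.1 this with h | h
      · exact h
      · exact absurd h (by positivity)
    subst hl0
    have hqq : q0 ^ 2 + q1 ^ 2 + q2 ^ 2 = 1 := by
      subst hq0 hq1 hq2
      linear_combination (p0 ^ 2 + p1 ^ 2 + p2 ^ 2) * hu + hp
        - (u0 * p0 + u1 * p1 + u2 * p2) * hup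
    have hpq : p0 * q0 + p1 * q1 + p2 * q2 = 0 := by
      subst hq0 hq1 hq2; ring
    have huq : u0 * q0 + u1 * q1 + u2 * q2 = 0 := by
      subst hq0 hq1 hq2; ring
    refine ⟨!![p0, q0, u0; p1, q1, u1; p2, q2, u2], ![w0, w1, w2], n, ?_, ?_, ?_⟩
    · rw [mul_eq_one_comm]
      ext i j
      fin_cases i <;> fin_cases j <;>
        simp [Matrix.mul_apply, Fin.sum_univ_three] <;> linarith
    · rw [Matrix.det_fin_three]
      simp
      linear_combination hp - p0 * hr0 - p1 * hr1 - p2 * hr2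
    · intro S R
      rw [hK]
      simp [cross, Matrix.mulVec, dotProduct, Fin.sum_univ_three]
      rw [c0, c1, c2]
      linear_combination n * S 2 * hu + n * S 0 * hup + n * S 1 * huq

end
end

section
/- Fix λ ∈ ℝ and (s₁,s₂,s₃,r₁,r₂,r₃) ∈ ℝ⁶, and let K = S₃ + λR₃. The curve γ(t) = ((s₁−λr₂t)cos t − (s₂+λr₁t)sin t, (s₂+λr₁t)cos t + (s₁−λr₂t)sin t, s₃, r₁cos t − r₂sin t, r₂cos t + r₁sin t, r₃) satisfies γ'(t) = sgrad K(γ(t)) for all t and γ(0) = (s₁,s₂,s₃,r₁,r₂,r₃). Moreover, if λ = 0 then γ is 2π-periodic, while if λ ≠ 0 and (r₁,r₂) ≠ (0,0) then γ is not periodic (there is no T > 0 with γ(t+T) = γ(t) for all t). -/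
noncomputable section

/-- the explicit solution of the Hamiltonian flow of K = S₃ + λR₃,
its 2π-periodicity for λ = 0, and non-periodicity for λ ≠ 0, (r₁,r₂) ≠ (0,0). -/
theorem statement2 (lam s₁ s₂ s₃ r₁ r₂ r₃ : ℝ) :
    let K : E6 → ℝ := fun y => y 2 + lam * y 5
    let γ : ℝ → E6 := fun t =>
      ![(s₁ - lam*r₂*t) * Real.cos t - (s₂ + lam*r₁*t) * Real.sin t,
        (s₂ + lam*r₁*t) * Real.cos t + (s₁ - lam*r₂*t) * Real.sin t,
        s₃,
        r₁ * Real.cos t - r₂ * Real.sin t,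
        r₂ * Real.cos t + r₁ * Real.sin t,
        r₃]
    (∀ t : ℝ, HasDerivAt γ (sgrad K (γ t)) t) ∧
    γ 0 = ![s₁, s₂, s₃, r₁, r₂, r₃] ∧
    (lam = 0 → ∀ t : ℝ, γ (t + 2 * Real.pi) = γ t) ∧
    (lam ≠ 0 → (r₁, r₂) ≠ (0, 0) → ¬ ∃ T > (0:ℝ), ∀ t : ℝ, γ (t + T) = γ t) := by
  intro K γ
  have hK : ∀ y : E6, HasFDerivAt K
      ((ContinuousLinearMap.proj 2 : E6 →L[ℝ] ℝ)
        + lam • (ContinuousLinearMap.proj 5 : E6 →L[ℝ] ℝ)) y := by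
    intro y
    exact (hasFDerivAt_apply (𝕜 := ℝ) (2 : Fin 6) y).add
      ((hasFDerivAt_apply (𝕜 := ℝ) (5 : Fin 6) y).const_mul lam)
  have hpd : ∀ (y : E6) (i : Fin 6), pd K y i =
      (Pi.single i 1 : E6) 2 + lam * (Pi.single i 1 : E6) 5 := by
    intro y i
    unfold pd
    rw [(hK y).fderiv]
    simp
  have hs : ∀ y : E6, sgrad K y =
      ![-y 1 - lam * y 4, y 0 + lam * y 3, 0, -y 4, y 3, 0] := by
    intro y
    ext i
    fin_cases i <;> simp [sgrad, pt, cross, Sv, Rv, hpd, Pi.single_apply] <;> ring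
  refine ⟨?_, ?_, ?_, ?_⟩
  · intro t
    rw [hs]
    have hc := Real.hasDerivAt_cos t
    have hsn := Real.hasDerivAt_sin t
    have hu : HasDerivAt (fun t : ℝ => s₁ - lam*r₂*t) (-(lam*r₂)) t := by
      simpa using ((hasDerivAt_id t).const_mul (lam*r₂)).const_sub s₁
    have hv : HasDerivAt (fun t : ℝ => s₂ + lam*r₁*t) (lam*r₁) t := by
      simpa using ((hasDerivAt_id t).const_mul (lam*r₁)).const_add s₂
    rw [hasDerivAt_pi]
    intro i
    fin_cases i
    · refine ((hu.mul hc).sub (hv.mul hsn)).congr_deriv ?_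
      simp [γ]
      ring
    · refine ((hv.mul hc).add (hu.mul hsn)).congr_deriv ?_
      simp [γ]
      ring
    · exact hasDerivAt_const t s₃
    · refine ((hc.const_mul r₁).sub (hsn.const_mul r₂)).congr_deriv ?_
      simp [γ]
      ring
    · refine ((hc.const_mul r₂).add (hsn.const_mul r₁)).congr_deriv ?_
      simp [γ]
      ring
    · exact hasDerivAt_const t r₃
  · simp [γ]
  · intro h t
    simp [γ, h]
  · rintro hl hr ⟨T, hT, h⟩
    have h0 := h 0
    have e : ∀ t, γ t 0 * γ t 4 - γ t 1 * γ t 3 =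
        s₁ * r₂ - s₂ * r₁ - lam * t * (r₁^2 + r₂^2) := by
      intro t
      simp [γ]
      linear_combination (s₁ * r₂ - s₂ * r₁ - lam * t * (r₁^2 + r₂^2)) *
        Real.sin_sq_add_cos_sq t
    have e1 := e T
    have e0 := e 0
    rw [zero_add] at h0
    rw [h0, e0] at e1
    have h1 : lam * T * (r₁^2 + r₂^2) = 0 := by linarith
    have h2 : r₁^2 + r₂^2 = 0 :=
      (mul_eq_zero.mp h1).resolve_left (mul_ne_zero hl hT.ne')
    apply hr
    have a1 : r₁ = 0 := by nlinarith [sq_nonneg r₁, sq_nonneg r₂]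
    have a2 : r₂ = 0 := by nlinarith [sq_nonneg r₁, sq_nonneg r₂]
    rw [a1, a2]

end
end

section
/- Let H(S,R) = A₁S₁² + A₂S₂² + A₃S₃² + f₁(R)S₁ + f₂(R)S₂ + f₃(R)S₃ + f₄(R), where A₁,A₂,A₃ ∈ ℝ and f₁,f₂,f₃,f₄: ℝ³ → ℝ are smooth. Suppose {H, S₃} = 0 identically on the open set {R₁²+R₂² > 0}. Then A₁ = A₂, and there exist functions g₁,g₂,g₃,V of two variables, smooth on {(u,w) ∈ ℝ² : u > w²}, such that for all (S,R) with R₁²+R₂² > 0: f₁(R)S₁ + f₂(R)S₂ + f₃(R)S₃ + f₄(R) = g₁(⟨R,R⟩,R₃)(S₁R₂−S₂R₁) + g₂(⟨R,R⟩,R₃)⟨S,R⟩ + g₃(⟨R,R⟩,R₃)S₃ + V(⟨R,R⟩,R₃). -/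
noncomputable section

/-- Simultaneous rotation of the S- and R-blocks about the third axis. -/
def rotE (y : E6) (t : ℝ) : E6 :=
  ![Real.cos t * y 0 + Real.sin t * y 1, -Real.sin t * y 0 + Real.cos t * y 1, y 2,
    Real.cos t * y 3 + Real.sin t * y 4, -Real.sin t * y 3 + Real.cos t * y 4, y 5]

lemma bracket_eq (H : E6 → ℝ) (y : E6) :
    bracket H (fun z => z 2) y
      = -(y 1 * pd H y 0 - y 0 * pd H y 1 + y 4 * pd H y 3 - y 3 * pd H y 4) := by
  have h : ∀ i, pd (fun z : E6 => z 2) y i = (Pi.single i (1:ℝ) : E6) 2 := by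
    intro i
    unfold pd
    have : HasFDerivAt (fun z : E6 => z 2) (ContinuousLinearMap.proj (R := ℝ) (φ := fun _ : Fin 6 => ℝ) 2) y :=
      (ContinuousLinearMap.proj (R := ℝ) (φ := fun _ : Fin 6 => ℝ) 2).hasFDerivAt
    rw [this.fderiv]
    rfl
  simp [bracket, h, dot, cross, Sv, Rv, Pi.single_apply]
  ring

lemma fderiv_apply_eq (H : E6 → ℝ) (y v : E6) :
    fderiv ℝ H y v = ∑ i, v i * pd H y i := by
  conv_lhs => rw [pi_eq_sum_univ' v]
  simp only [map_sum, map_smul, smul_eq_mul, pd]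

lemma rot_invariant (H : E6 → ℝ) (hd : Differentiable ℝ H)
    (hcomm : ∀ y : E6, (y 3)^2 + (y 4)^2 > 0 → bracket H (fun z => z 2) y = 0)
    (y : E6) (hy : (y 3)^2 + (y 4)^2 > 0) (t : ℝ) : H (rotE y t) = H y := by
  have hder : ∀ t, HasDerivAt (fun t => H (rotE y t)) 0 t := by
    intro t
    have h1 : HasDerivAt (rotE y)
        ![-Real.sin t * y 0 + Real.cos t * y 1, -Real.cos t * y 0 + -Real.sin t * y 1, 0,
          -Real.sin t * y 3 + Real.cos t * y 4, -Real.cos t * y 3 + -Real.sin t * y 4, 0] t := by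
      rw [hasDerivAt_pi]
      have hc := Real.hasDerivAt_cos t
      have hs := Real.hasDerivAt_sin t
      intro i
      fin_cases i
      · exact (hc.mul_const _).add (hs.mul_const _)
      · exact (hs.neg.mul_const _).add (hc.mul_const _)
      · exact hasDerivAt_const _ _
      · exact (hc.mul_const _).add (hs.mul_const _)
      · exact (hs.neg.mul_const _).add (hc.mul_const _)
      · exact hasDerivAt_const _ _
    have h2 := (hd (rotE y t)).hasFDerivAt.comp_hasDerivAt t h1
    refine h2.congr_deriv ?_
    rw [fderiv_apply_eq]
    have h3 := hcomm (rotE y t) (by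
      simp only [rotE, Matrix.cons_val]
      nlinarith [Real.sin_sq_add_cos_sq t, hy])
    rw [bracket_eq] at h3
    simp only [Fin.sum_univ_six, Matrix.cons_val]
    have e0 : rotE y t 0 = Real.cos t * y 0 + Real.sin t * y 1 := rfl
    have e1 : rotE y t 1 = -Real.sin t * y 0 + Real.cos t * y 1 := rfl
    have e3 : rotE y t 3 = Real.cos t * y 3 + Real.sin t * y 4 := rfl
    have e4 : rotE y t 4 = -Real.sin t * y 3 + Real.cos t * y 4 := rfl
    rw [e0, e1, e3, e4] at h3
    linarith
  have h4 := is_const_of_deriv_eq_zero (fun t => (hder t).differentiableAt)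
    (fun t => (hder t).deriv) t 0
  have h5 : rotE y 0 = y := by
    ext i
    fin_cases i <;> simp [rotE]
  simpa [h5] using h4

lemma exists_angle (c s : ℝ) (h : c^2 + s^2 = 1) : ∃ t, Real.cos t = c ∧ Real.sin t = s := by
  have hn : ‖(⟨c, s⟩ : ℂ)‖ = 1 := by
    rw [Complex.norm_def, Complex.normSq_mk, Real.sqrt_eq_one]
    linarith
  have h0 : (⟨c, s⟩ : ℂ) ≠ 0 := by
    intro h; rw [h] at hn; simp at hn
  refine ⟨Complex.arg ⟨c, s⟩, ?_, ?_⟩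
  · rw [Complex.cos_arg h0, hn]; simp
  · rw [Complex.sin_arg, hn]; simp

lemma smooth_slice (f : (Fin 3 → ℝ) → ℝ) (hf : ContDiff ℝ (⊤ : ℕ∞) f) :
    ContDiffOn ℝ (⊤ : ℕ∞) (fun p : ℝ × ℝ => f ![Real.sqrt (p.1 - p.2^2), 0, p.2])
      {p : ℝ × ℝ | p.2^2 < p.1} := by
  refine hf.comp_contDiffOn ?_
  rw [contDiffOn_pi]
  intro i
  fin_cases i
  · refine ContDiffOn.sqrt (by fun_prop) ?_
    intro p hp
    have : p.2^2 < p.1 := hp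
    exact (sub_pos.2 this).ne'
  · exact contDiffOn_const
  · exact contDiffOn_snd

lemma smooth_slice_div (f : (Fin 3 → ℝ) → ℝ) (hf : ContDiff ℝ (⊤ : ℕ∞) f) :
    ContDiffOn ℝ (⊤ : ℕ∞)
      (fun p : ℝ × ℝ => f ![Real.sqrt (p.1 - p.2^2), 0, p.2] / Real.sqrt (p.1 - p.2^2))
      {p : ℝ × ℝ | p.2^2 < p.1} := by
  have hpos : ∀ p ∈ {p : ℝ × ℝ | p.2^2 < p.1}, 0 < p.1 - p.2^2 := fun p hp => sub_pos.2 hp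
  refine (smooth_slice f hf).div (ContDiffOn.sqrt (by fun_prop) fun p hp => (hpos p hp).ne') ?_
  intro p hp
  exact (Real.sqrt_pos.2 (hpos p hp)).ne'

/-- a Hamiltonian quadratic in S commuting with S₃ on {R₁²+R₂²>0}
has A₁ = A₂ and its lower-order part can be written through functions of (⟨R,R⟩, R₃). -/
theorem statement3 (A₁ A₂ A₃ : ℝ) (f₁ f₂ f₃ f₄ : (Fin 3 → ℝ) → ℝ)
    (hf₁ : ContDiff ℝ (⊤ : ℕ∞) f₁) (hf₂ : ContDiff ℝ (⊤ : ℕ∞) f₂)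
    (hf₃ : ContDiff ℝ (⊤ : ℕ∞) f₃) (hf₄ : ContDiff ℝ (⊤ : ℕ∞) f₄)
    (H : E6 → ℝ)
    (hH : H = fun y => A₁ * (y 0)^2 + A₂ * (y 1)^2 + A₃ * (y 2)^2
      + f₁ (Rv y) * y 0 + f₂ (Rv y) * y 1 + f₃ (Rv y) * y 2 + f₄ (Rv y))
    (hcomm : ∀ y : E6, (y 3)^2 + (y 4)^2 > 0 → bracket H (fun z => z 2) y = 0) :
    A₁ = A₂ ∧
    ∃ g₁ g₂ g₃ V : ℝ × ℝ → ℝ,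
      ContDiffOn ℝ (⊤ : ℕ∞) g₁ {p : ℝ × ℝ | p.2^2 < p.1} ∧
      ContDiffOn ℝ (⊤ : ℕ∞) g₂ {p : ℝ × ℝ | p.2^2 < p.1} ∧
      ContDiffOn ℝ (⊤ : ℕ∞) g₃ {p : ℝ × ℝ | p.2^2 < p.1} ∧
      ContDiffOn ℝ (⊤ : ℕ∞) V {p : ℝ × ℝ | p.2^2 < p.1} ∧
      ∀ y : E6, (y 3)^2 + (y 4)^2 > 0 →
        f₁ (Rv y) * y 0 + f₂ (Rv y) * y 1 + f₃ (Rv y) * y 2 + f₄ (Rv y)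
          = g₁ ((y 3)^2 + (y 4)^2 + (y 5)^2, y 5) * (y 0 * y 4 - y 1 * y 3)
          + g₂ ((y 3)^2 + (y 4)^2 + (y 5)^2, y 5) * (y 0 * y 3 + y 1 * y 4 + y 2 * y 5)
          + g₃ ((y 3)^2 + (y 4)^2 + (y 5)^2, y 5) * y 2
          + V ((y 3)^2 + (y 4)^2 + (y 5)^2, y 5) := by
  have hd : Differentiable ℝ H := by
    have hR : Differentiable ℝ Rv := by
      rw [differentiable_pi]
      intro i
      fin_cases i
      · exact differentiable_apply (3 : Fin 6)
      · exact differentiable_apply (4 : Fin 6)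
      · exact differentiable_apply (5 : Fin 6)
    have d1 := (hf₁.differentiable (by simp)).comp hR
    have d2 := (hf₂.differentiable (by simp)).comp hR
    have d3 := (hf₃.differentiable (by simp)).comp hR
    have d4 := (hf₄.differentiable (by simp)).comp hR
    simp only [Function.comp_def] at d1 d2 d3 d4
    have p : ∀ i : Fin 6, Differentiable ℝ (fun y : E6 => y i) := fun i => differentiable_apply i
    rw [hH]
    exact (((((((p 0).pow 2).const_mul A₁).add (((p 1).pow 2).const_mul A₂)).add
      (((p 2).pow 2).const_mul A₃)).add (d1.mul (p 0))).add (d2.mul (p 1))).add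
      (d3.mul (p 2)) |>.add d4
  have hrot := rot_invariant H hd hcomm
  have hA : A₁ = A₂ := by
    have k : ∀ l : ℝ, A₂ * l^2 - f₂ ![0, -1, 0] * l + f₄ ![0, -1, 0]
        = A₁ * l^2 + f₁ ![1, 0, 0] * l + f₄ ![1, 0, 0] := by
      intro l
      have := hrot ![l, 0, 0, 1, 0, 0] (by simp) (Real.pi / 2)
      simp [hH, rotE, Rv] at this
      linarith
    have k1 := k 1
    have k2 := k (-1)
    have k3 := k 0
    linarith
  refine ⟨hA, fun p => -(f₂ ![Real.sqrt (p.1 - p.2^2), 0, p.2] / Real.sqrt (p.1 - p.2^2)),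
    fun p => f₁ ![Real.sqrt (p.1 - p.2^2), 0, p.2] / Real.sqrt (p.1 - p.2^2),
    fun p => f₃ ![Real.sqrt (p.1 - p.2^2), 0, p.2]
      - p.2 * (f₁ ![Real.sqrt (p.1 - p.2^2), 0, p.2] / Real.sqrt (p.1 - p.2^2)),
    fun p => f₄ ![Real.sqrt (p.1 - p.2^2), 0, p.2],
    (smooth_slice_div f₂ hf₂).neg, smooth_slice_div f₁ hf₁,
    (smooth_slice f₃ hf₃).sub (contDiffOn_snd.mul (smooth_slice_div f₁ hf₁)),
    smooth_slice f₄ hf₄, ?_⟩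
  intro y hy
  simp only [add_sub_cancel_right]
  set r := Real.sqrt ((y 3)^2 + (y 4)^2) with hr
  have hrpos : 0 < r := Real.sqrt_pos.2 hy
  have hrsq : r^2 = (y 3)^2 + (y 4)^2 := Real.sq_sqrt hy.le
  obtain ⟨t, hc, hs⟩ := exists_angle (y 3 / r) (y 4 / r) (by
    rw [div_pow, div_pow, ← add_div, ← hrsq]
    exact div_self (by positivity))
  have key := hrot y hy t
  have hRv : Rv (rotE y t) = ![r, 0, y 5] := by
    have a1 : y 3 / r * y 3 + y 4 / r * y 4 = r := by
      field_simp
      linarith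
    have a2 : -(y 4 / r) * y 3 + y 3 / r * y 4 = 0 := by
      field_simp
      ring
    simp only [Rv, rotE, hc, hs, Matrix.cons_val, a1, a2]
  have e0 : rotE y t 0 = y 3 / r * y 0 + y 4 / r * y 1 := by rw [← hc, ← hs]; rfl
  have e1 : rotE y t 1 = -(y 4 / r) * y 0 + y 3 / r * y 1 := by rw [← hc, ← hs]; rfl
  have e2 : rotE y t 2 = y 2 := rfl
  rw [hH] at key
  simp only [hRv, e0, e1, e2] at key
  have hcs : (y 3 / r)^2 + (y 4 / r)^2 = 1 := by
    rw [← hc, ← hs]; exact Real.cos_sq_add_sin_sq t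
  have hq : A₁ * (y 3 / r * y 0 + y 4 / r * y 1)^2 + A₂ * (-(y 4 / r) * y 0 + y 3 / r * y 1)^2
      = A₁ * (y 0)^2 + A₂ * (y 1)^2 := by
    rw [← hA]
    linear_combination A₁ * ((y 0)^2 + (y 1)^2) * hcs
  linear_combination hq - key

end
end

section
/- Let H: ℝ⁶ → ℝ be smooth with {H, S₃} = 0 identically. Then the set of points y ∈ ℝ⁶ at which both sgrad H(y) = 0 and sgrad S₃(y) = 0 equals the two-dimensional plane {(0,0,S₃,0,0,R₃) : S₃,R₃ ∈ ℝ}. Consequently, for any a > 0 and g ∈ ℝ, the points of this plane lying on the orbit M⁴_{a,g} = {⟨R,R⟩ = a, ⟨S,R⟩ = g} are exactly the two points (0,0,±g/√a,0,0,±√a). -/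
noncomputable section

theorem aux_pd2 (y : E6) (i : Fin 6) : pd (fun z : E6 => z 2) y i = if i = 2 then 1 else 0 := by
  have h : HasFDerivAt (fun z : E6 => z 2) (ContinuousLinearMap.proj (R := ℝ) (φ := fun _ : Fin 6 => ℝ) 2) y :=
    (ContinuousLinearMap.proj (R := ℝ) (φ := fun _ : Fin 6 => ℝ) 2).hasFDerivAt
  unfold pd
  rw [h.fderiv]
  simp [Pi.single_apply, eq_comm]

theorem aux_sgrad2 (y : E6) : sgrad (fun z : E6 => z 2) y = ![-y 1, y 0, 0, -y 4, y 3, 0] := by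
  unfold sgrad
  simp only [aux_pd2]
  ext i
  fin_cases i <;> simp [pt, cross, Sv, Rv]

theorem aux_bracket (H : E6 → ℝ) (y : E6) : bracket H (fun z => z 2) y
    = y 0 * pd H y 1 - y 1 * pd H y 0 + y 3 * pd H y 4 - y 4 * pd H y 3 := by
  unfold bracket
  simp only [aux_pd2]
  simp [dot, cross, Sv, Rv]
  ring

theorem aux_pd_cont (H : E6 → ℝ) (hH : ContDiff ℝ (⊤ : ℕ∞) H) (j : Fin 6) :
    Continuous (fun y => pd H y j) := by
  unfold pd
  exact (hH.continuous_fderiv (by simp)).clm_apply continuous_const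

theorem aux_coord (y : E6) (t : ℝ) (i k : Fin 6) :
    (y + t • (Pi.single i 1 : E6)) k = y k + t * (if k = i then 1 else 0) := by
  rw [Pi.add_apply, Pi.smul_apply, Pi.single_apply, smul_eq_mul]

theorem aux_zero (H : E6 → ℝ) (hH : ContDiff ℝ (⊤ : ℕ∞) H) (j i : Fin 6) (y : E6)
    (h : ∀ t : ℝ, t * pd H (y + t • Pi.single i 1) j = 0) : pd H y j = 0 := by
  have hc : Continuous (fun t : ℝ => pd H (y + t • (Pi.single i 1 : E6)) j) :=
    (aux_pd_cont H hH j).comp (by fun_prop)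
  have h0 : ∀ t ∈ ({0}ᶜ : Set ℝ), pd H (y + t • (Pi.single i 1 : E6)) j = 0 := fun t ht =>
    (mul_eq_zero.1 (h t)).resolve_left ht
  have := Continuous.ext_on (dense_compl_singleton (0 : ℝ)) hc continuous_const h0
  simpa using congrFun this 0

/-- for a smooth H commuting with K = S₃, the common zeros of
sgrad H and sgrad K form the plane {S₁=S₂=R₁=R₂=0}; on each orbit M⁴_{a,g}
this plane meets exactly the two points (0,0,±g/√a,0,0,±√a). -/
theorem statement4 (H : E6 → ℝ) (hH : ContDiff ℝ (⊤ : ℕ∞) H)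
    (hcomm : ∀ y : E6, bracket H (fun z => z 2) y = 0) :
    ({y : E6 | sgrad H y = 0 ∧ sgrad (fun z : E6 => z 2) y = 0}
      = {y : E6 | y 0 = 0 ∧ y 1 = 0 ∧ y 3 = 0 ∧ y 4 = 0}) ∧
    ∀ a g : ℝ, 0 < a →
      {y : E6 | (y 0 = 0 ∧ y 1 = 0 ∧ y 3 = 0 ∧ y 4 = 0) ∧
          (y 3)^2 + (y 4)^2 + (y 5)^2 = a ∧
          y 0 * y 3 + y 1 * y 4 + y 2 * y 5 = g}
        = {![0, 0, g / Real.sqrt a, 0, 0, Real.sqrt a],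
           ![0, 0, -(g / Real.sqrt a), 0, 0, -Real.sqrt a]} := by
  constructor
  · ext y
    simp only [Set.mem_ofPred_eq, aux_sgrad2]
    constructor
    · rintro ⟨-, h⟩
      have h0 := congrFun h 0
      have h1 := congrFun h 1
      have h3 := congrFun h 3
      have h4 := congrFun h 4
      simp at h0 h1 h3 h4
      exact ⟨h1, h0, h4, h3⟩
    · rintro ⟨y0, y1, y3, y4⟩
      have hb : ∀ y : E6,
          y 0 * pd H y 1 - y 1 * pd H y 0 + y 3 * pd H y 4 - y 4 * pd H y 3 = 0 := fun y => by
        rw [← aux_bracket]; exact hcomm y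
      have e1 : pd H y 1 = 0 := aux_zero H hH 1 0 y fun t => by
        have h := hb (y + t • (Pi.single 0 1 : E6))
        simp only [aux_coord, y0, y1, y3, y4] at h
        norm_num at h
        simpa using h
      have e0 : pd H y 0 = 0 := aux_zero H hH 0 1 y fun t => by
        have h := hb (y + t • (Pi.single 1 1 : E6))
        simp only [aux_coord, y0, y1, y3, y4] at h
        norm_num at h
        simpa using h
      have e4 : pd H y 4 = 0 := aux_zero H hH 4 3 y fun t => by
        have h := hb (y + t • (Pi.single 3 1 : E6))
        simp only [aux_coord, y0, y1, y3, y4] at h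
        norm_num at h
        simpa using h
      have e3 : pd H y 3 = 0 := aux_zero H hH 3 4 y fun t => by
        have h := hb (y + t • (Pi.single 4 1 : E6))
        simp only [aux_coord, y0, y1, y3, y4] at h
        norm_num at h
        simpa using h
      constructor
      · ext i
        fin_cases i <;> simp [sgrad, pt, cross, Sv, Rv, y0, y1, y3, y4, e0, e1, e3, e4]
      · ext i
        fin_cases i <;> simp [y0, y1, y3, y4]
  · intro a g ha
    have hs : 0 < Real.sqrt a := Real.sqrt_pos.2 ha
    have hsq : Real.sqrt a ^ 2 = a := Real.sq_sqrt ha.le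
    ext y
    simp only [Set.mem_ofPred_eq, Set.mem_insert_iff, Set.mem_singleton_iff]
    constructor
    · rintro ⟨⟨y0, y1, y3, y4⟩, h1, h2⟩
      simp only [y0, y1, y3, y4] at h1 h2
      have h5 : (y 5) ^ 2 = Real.sqrt a ^ 2 := by rw [hsq]; linarith
      rcases sq_eq_sq_iff_eq_or_eq_neg.1 h5 with h | h
      · left
        have h6 : y 2 = g / Real.sqrt a := by
          rw [eq_div_iff hs.ne', ← h]; linarith
        ext i
        fin_cases i <;> simp [y0, y1, y3, y4, h, h6]
      · right
        have h6 : y 2 = -(g / Real.sqrt a) := by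
          rw [← neg_div, eq_div_iff hs.ne']; rw [h] at h2; linarith
        ext i
        fin_cases i <;> simp [y0, y1, y3, y4, h, h6]
    · rintro (rfl | rfl)
      · simp [hsq, hs.ne']
      · simp [hsq, hs.ne']

end
end

section
/- Let H be the Hamiltonian of form (4) and K = S₃. If y = (S₁,S₂,S₃,0,0,R₃) ∈ ℝ⁶ with R₃ ≠ 0 is a point such that sgrad H(y) = λ·sgrad K(y) for some λ ∈ ℝ, then S₁ = S₂ = 0. In particular, the subspace {R₁ = R₂ = 0, R₃ ≠ 0} contains no points where sgrad H and sgrad K are linearly dependent and not both zero. -/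
noncomputable section

theorem pd_eq_of_line {f : E6 → ℝ} {y : E6} (hf : DifferentiableAt ℝ f y) (i : Fin 6) {c : ℝ}
    (h : HasDerivAt (fun t : ℝ => f (y + t • (Pi.single i 1 : E6))) c 0) : pd f y i = c := by
  have h1 : HasLineDerivAt ℝ f c y (Pi.single i 1) := h
  exact (hf.hasFDerivAt.hasLineDerivAt (Pi.single i 1)).unique h1

theorem pd_eq_zero_of_even {f : E6 → ℝ} {y : E6} (hf : DifferentiableAt ℝ f y) (i : Fin 6)
    (h : ∀ t : ℝ, f (y + (-t) • (Pi.single i 1 : E6)) = f (y + t • (Pi.single i 1 : E6))) :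
    pd f y i = 0 := by
  have h1 : HasDerivAt (fun t : ℝ => f (y + t • (Pi.single i 1 : E6))) (pd f y i) 0 :=
    hf.hasFDerivAt.hasLineDerivAt (Pi.single i 1)
  have h2 : HasDerivAt (fun t : ℝ => f (y + (-t) • (Pi.single i 1 : E6))) (-(pd f y i)) 0 := by
    have h1' : HasDerivAt (fun t : ℝ => f (y + t • (Pi.single i 1 : E6))) (pd f y i) (-0) := by
      simpa using h1
    have := HasDerivAt.comp (0 : ℝ) h1' (hasDerivAt_neg (0 : ℝ))
    simpa [Function.comp_def] using this
  simp only [h] at h2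
  have := h1.unique h2
  linarith

theorem H4_diff (β : ℝ) (g₁ g₂ g₃ V : ℝ → ℝ → ℝ)
    (hg₁ : ContDiff ℝ (⊤ : ℕ∞) (Function.uncurry g₁))
    (hg₂ : ContDiff ℝ (⊤ : ℕ∞) (Function.uncurry g₂))
    (hg₃ : ContDiff ℝ (⊤ : ℕ∞) (Function.uncurry g₃))
    (hV : ContDiff ℝ (⊤ : ℕ∞) (Function.uncurry V)) :
    Differentiable ℝ (H4 β g₁ g₂ g₃ V) := by
  have key : ∀ g : ℝ → ℝ → ℝ, ContDiff ℝ (⊤ : ℕ∞) (Function.uncurry g) →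
      Differentiable ℝ (fun y : E6 => g ((y 3)^2 + (y 4)^2 + (y 5)^2) (y 5)) := by
    intro g hg
    have hd : Differentiable ℝ (Function.uncurry g) := hg.differentiable (by simp)
    have hi : Differentiable ℝ (fun y : E6 => ((y 3)^2 + (y 4)^2 + (y 5)^2, y 5)) := by fun_prop
    exact hd.comp hi
  have k1 := key g₁ hg₁
  have k2 := key g₂ hg₂
  have k3 := key g₃ hg₃
  have k4 := key V hV
  unfold H4
  simp only [div_eq_mul_inv]
  refine ((((?_ : Differentiable ℝ _).add (k1.mul ?_)).add (k2.mul ?_)).add (k3.mul ?_)).add k4 <;>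
    fun_prop

theorem pdK (y : E6) (i : Fin 6) : pd (fun z => z 2) y i = (Pi.single i 1 : E6) 2 := by
  apply pd_eq_of_line (by fun_prop)
  simp only [Pi.add_apply, Pi.smul_apply, smul_eq_mul]
  simpa using ((hasDerivAt_id (0:ℝ)).mul_const ((Pi.single i 1 : E6) 2)).const_add (y 2)

theorem quad_deriv (a b : ℝ) : HasDerivAt (fun t : ℝ => a + b * t + t ^ 2 / 2) b 0 := by
  have := (((hasDerivAt_id (0:ℝ)).const_mul b).const_add a).add
    (((hasDerivAt_id (0:ℝ)).pow 2).div_const 2)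
  refine HasDerivAt.congr_deriv (f' := _) this ?_
  simp

theorem pdH0 {β : ℝ} {g₁ g₂ g₃ V : ℝ → ℝ → ℝ} {y : E6}
    (hd : Differentiable ℝ (H4 β g₁ g₂ g₃ V)) (h3 : y 3 = 0) (h4 : y 4 = 0) :
    pd (H4 β g₁ g₂ g₃ V) y 0 = y 0 := by
  apply pd_eq_of_line (hd y)
  convert quad_deriv (H4 β g₁ g₂ g₃ V y) (y 0) using 1
  funext t
  simp [H4, h3, h4, Pi.single_apply]
  ring

theorem pdH1 {β : ℝ} {g₁ g₂ g₃ V : ℝ → ℝ → ℝ} {y : E6}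
    (hd : Differentiable ℝ (H4 β g₁ g₂ g₃ V)) (h3 : y 3 = 0) (h4 : y 4 = 0) :
    pd (H4 β g₁ g₂ g₃ V) y 1 = y 1 := by
  apply pd_eq_of_line (hd y)
  convert quad_deriv (H4 β g₁ g₂ g₃ V y) (y 1) using 1
  funext t
  simp [H4, h3, h4, Pi.single_apply]
  ring

theorem pdH3 {β : ℝ} {g₁ g₂ g₃ V : ℝ → ℝ → ℝ} {y : E6}
    (hd : Differentiable ℝ (H4 β g₁ g₂ g₃ V)) (h0 : y 0 = 0) (h1 : y 1 = 0)
    (h3 : y 3 = 0) (h4 : y 4 = 0) :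
    pd (H4 β g₁ g₂ g₃ V) y 3 = 0 := by
  apply pd_eq_zero_of_even (hd y)
  intro t
  simp [H4, h0, h1, h3, h4, Pi.single_apply]

theorem pdH4 {β : ℝ} {g₁ g₂ g₃ V : ℝ → ℝ → ℝ} {y : E6}
    (hd : Differentiable ℝ (H4 β g₁ g₂ g₃ V)) (h0 : y 0 = 0) (h1 : y 1 = 0)
    (h3 : y 3 = 0) (h4 : y 4 = 0) :
    pd (H4 β g₁ g₂ g₃ V) y 4 = 0 := by
  apply pd_eq_zero_of_even (hd y)
  intro t
  simp [H4, h0, h1, h3, h4, Pi.single_apply]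

theorem sgradK (y : E6) : sgrad (fun z => z 2) y = ![-y 1, y 0, 0, -y 4, y 3, 0] := by
  funext i
  fin_cases i <;> simp [sgrad, pt, cross, Sv, Rv, pdK, Pi.single_apply]

/-- on {R₁ = R₂ = 0, R₃ ≠ 0}, if sgrad H = λ·sgrad K then S₁ = S₂ = 0;
in particular this subspace contains no points where sgrad H and sgrad K are
linearly dependent without both vanishing. -/
theorem statement6 (β : ℝ) (hβ : 0 < β) (g₁ g₂ g₃ V : ℝ → ℝ → ℝ)
    (hg₁ : ContDiff ℝ (⊤ : ℕ∞) (Function.uncurry g₁))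
    (hg₂ : ContDiff ℝ (⊤ : ℕ∞) (Function.uncurry g₂))
    (hg₃ : ContDiff ℝ (⊤ : ℕ∞) (Function.uncurry g₃))
    (hV : ContDiff ℝ (⊤ : ℕ∞) (Function.uncurry V)) :
    let H : E6 → ℝ := H4 β g₁ g₂ g₃ V
    let K : E6 → ℝ := fun z => z 2
    (∀ S₁ S₂ S₃ R₃ : ℝ, R₃ ≠ 0 → ∀ lam : ℝ,
        sgrad H ![S₁, S₂, S₃, 0, 0, R₃] = lam • sgrad K ![S₁, S₂, S₃, 0, 0, R₃] →
        S₁ = 0 ∧ S₂ = 0) ∧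
    (∀ y : E6, y 3 = 0 → y 4 = 0 → y 5 ≠ 0 →
      ¬ (¬ LinearIndependent ℝ ![sgrad H y, sgrad K y] ∧
          ¬ (sgrad H y = 0 ∧ sgrad K y = 0))) := by
  intro H K
  have hd := H4_diff β g₁ g₂ g₃ V hg₁ hg₂ hg₃ hV
  have c3 : ∀ y : E6, y 3 = 0 → y 4 = 0 → sgrad H y 3 = y 1 * y 5 := by
    intro y h3 h4
    simp [sgrad, pt, cross, Rv, H, pdH1 hd h3 h4, h4]
  have c4 : ∀ y : E6, y 3 = 0 → y 4 = 0 → sgrad H y 4 = -(y 0 * y 5) := by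
    intro y h3 h4
    simp [sgrad, pt, cross, Rv, H, pdH0 hd h3 h4, h3]
  have hK : ∀ y, sgrad K y = ![-y 1, y 0, 0, -y 4, y 3, 0] := sgradK
  constructor
  · intro S₁ S₂ S₃ R₃ hR lam h
    have e3 := congrFun h 3
    have e4 := congrFun h 4
    rw [c3 _ (by simp) (by simp), hK] at e3
    rw [c4 _ (by simp) (by simp), hK] at e4
    simp [hR] at e3 e4
    exact ⟨e4, e3⟩
  · rintro y h3 h4 h5 ⟨hl, hz⟩
    by_cases h01 : y 0 = 0 ∧ y 1 = 0
    · obtain ⟨h0, h1⟩ := h01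
      apply hz
      constructor
      · funext i
        fin_cases i <;> simp [sgrad, pt, cross, Sv, Rv, H, pdH0 hd h3 h4, pdH1 hd h3 h4,
          pdH3 hd h0 h1 h3 h4, pdH4 hd h0 h1 h3 h4, h0, h1, h3, h4]
      · rw [hK]
        funext i
        fin_cases i <;> simp [h0, h1, h3, h4]
    · apply hl
      rw [LinearIndependent.pair_iff]
      intro s t h
      have e0 := congrFun h 0
      have e1 := congrFun h 1
      have e3 := congrFun h 3
      have e4 := congrFun h 4
      simp only [Pi.add_apply, Pi.smul_apply, smul_eq_mul, hK, c3 y h3 h4, c4 y h3 h4] at e0 e1 e3 e4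
      simp [h3, h4, h5] at e0 e1 e3 e4
      have hs : s = 0 := by tauto
      subst hs
      simp at e0 e1
      exact ⟨rfl, by tauto⟩

end
end

section
/- Fix a > 0 and g, k ∈ ℝ, and define Ĥ(x,m) = ((g−kx)² + m²)/(2(a−x²)) + k²/(2β) + g₁(a,x)·m + g₂(a,x)·g + g₃(a,x)·k + V(a,x) for x² < a, m ∈ ℝ. Then at every point (x,m) with m = −(a−x²)·g₁(a,x): ∂²Ĥ/∂m² = 1/(a−x²), ∂²Ĥ/∂x∂m = ∂₂g₁(a,x) − 2x·g₁(a,x)/(a−x²), and (∂²Ĥ/∂m²)·(∂²Ĥ/∂x²) − (∂²Ĥ/∂x∂m)² = (1/(a−x²))·∂²W_{a,g}/∂x²(k,x). -/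
noncomputable section

/-- A smooth function of two variables has, for a fixed first argument, first and second
derivatives in the second argument. -/
theorem slice_derivs (f : ℝ → ℝ → ℝ) (hf : ContDiff ℝ (⊤ : ℕ∞) (Function.uncurry f)) (a : ℝ) :
    (∀ u, HasDerivAt (f a) (deriv (f a) u) u) ∧
    (∀ u, HasDerivAt (deriv (f a)) (deriv (deriv (f a)) u) u) := by
  have h : ContDiff ℝ (⊤ : ℕ∞) (f a) := by
    have h2 : ContDiff ℝ (⊤ : ℕ∞) (fun u : ℝ => ((a, u) : ℝ × ℝ)) := by fun_prop
    exact hf.comp h2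
  have h' : ContDiff ℝ (⊤ : ℕ∞) (deriv (f a)) := (contDiff_infty_iff_deriv.1 h).2
  exact ⟨fun u => ((contDiff_infty_iff_deriv.1 h).1 u).hasDerivAt,
    fun u => ((contDiff_infty_iff_deriv.1 h').1 u).hasDerivAt⟩

/-- The first two derivatives of `((g - k u)² + c) / (2 (a - u²))`. -/
theorem frac_deriv (a g k c u : ℝ) (hu : a - u^2 ≠ 0) :
    HasDerivAt (fun u => ((g - k*u)^2 + c) / (2*(a - u^2)))
      (-(k*(g-k*u))/(a-u^2) + ((g-k*u)^2+c)*u/(a-u^2)^2) u := by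
  have h1 : HasDerivAt (fun u : ℝ => (g - k*u)^2 + c) (2*(g-k*u)*(-k)) u := by
    have := ((((hasDerivAt_id u).const_mul k).const_sub g).pow 2).add_const c
    refine this.congr_deriv ?_
    simp
  have h2 : HasDerivAt (fun u : ℝ => 2*(a - u^2)) (2*(-(2*u))) u := by
    have := ((((hasDerivAt_id u).pow 2).const_sub a).const_mul 2)
    refine this.congr_deriv ?_
    simp
  refine HasDerivAt.congr_deriv (h1.div h2 (by simpa using hu)) ?_
  field_simp
  ring

theorem frac_deriv2 (a g k c u : ℝ) (hu : a - u^2 ≠ 0) :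
    HasDerivAt (fun u => -(k*(g-k*u))/(a-u^2) + ((g-k*u)^2+c)*u/(a-u^2)^2)
      (k^2/(a-u^2) - 4*k*(g-k*u)*u/(a-u^2)^2
        + ((g-k*u)^2+c)*(1/(a-u^2)^2 + 4*u^2/(a-u^2)^3)) u := by
  have h1 : HasDerivAt (fun u : ℝ => -(k*(g - k*u))) (k^2) u := by
    have := ((((hasDerivAt_id u).const_mul k).const_sub g).const_mul k).neg
    refine this.congr_deriv ?_
    simp
    ring
  have h3 : HasDerivAt (fun u : ℝ => ((g - k*u)^2 + c)*u)
      (2*(g-k*u)*(-k)*u + ((g-k*u)^2+c)) u := by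
    have := (((((hasDerivAt_id u).const_mul k).const_sub g).pow 2).add_const c).mul
      (hasDerivAt_id u)
    refine this.congr_deriv ?_
    simp
  have h2 : HasDerivAt (fun u : ℝ => a - u^2) (-(2*u)) u := by
    have := (((hasDerivAt_id u).pow 2).const_sub a)
    refine this.congr_deriv ?_
    simp
  refine HasDerivAt.congr_deriv ((h1.div h2 hu).add (h3.div (h2.pow 2) (pow_ne_zero 2 hu))) ?_
  simp
  field_simp
  ring

/-- second partial derivatives of the reduced Hamiltonian Ĥ(x,m)
at points with m = −(a−x²)·g₁(a,x). -/
theorem statement15 (β : ℝ) (hβ : 0 < β) (g₁ g₂ g₃ V : ℝ → ℝ → ℝ)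
    (hg₁ : ContDiff ℝ (⊤ : ℕ∞) (Function.uncurry g₁))
    (hg₂ : ContDiff ℝ (⊤ : ℕ∞) (Function.uncurry g₂))
    (hg₃ : ContDiff ℝ (⊤ : ℕ∞) (Function.uncurry g₃))
    (hV : ContDiff ℝ (⊤ : ℕ∞) (Function.uncurry V))
    (a g k : ℝ) (ha : 0 < a) (x m : ℝ) (hx : x^2 < a)
    (hm : m = -((a - x^2) * g₁ a x)) :
    let Hh : ℝ → ℝ → ℝ := fun u t =>
      ((g - k*u)^2 + t^2) / (2*(a - u^2)) + k^2/(2*β)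
        + g₁ a u * t + g₂ a u * g + g₃ a u * k + V a u
    deriv (deriv (Hh x)) m = 1/(a - x^2) ∧
    deriv (fun u => deriv (Hh u) m) x
      = deriv (g₁ a) x - 2*x*(g₁ a x)/(a - x^2) ∧
    deriv (deriv (Hh x)) m * deriv (deriv (fun u => Hh u m)) x
        - (deriv (fun u => deriv (Hh u) m) x)^2
      = (1/(a - x^2)) * deriv (deriv (fun t => W β g₁ g₂ g₃ V a g k t)) x := by
  intro Hh
  have hD : ∀ u : ℝ, u^2 < a → a - u^2 ≠ 0 := fun u hu => (sub_pos.2 hu).ne'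
  have hev : ∀ᶠ u in nhds x, u^2 < a :=
    (isOpen_lt (by fun_prop) continuous_const).mem_nhds hx
  have hDx := hD x hx
  obtain ⟨p1, p2⟩ := slice_derivs g₁ hg₁ a
  obtain ⟨q1, q2⟩ := slice_derivs g₂ hg₂ a
  obtain ⟨r1, r2⟩ := slice_derivs g₃ hg₃ a
  obtain ⟨v1, v2⟩ := slice_derivs V hV a
  have hHm : ∀ u : ℝ, ∀ t, deriv (Hh u) t = t/(a-u^2) + g₁ a u := by
    intro u t
    have h := ((((((((hasDerivAt_id t).pow 2).const_add ((g-k*u)^2)).div_const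
      (2*(a-u^2))).add_const (k^2/(2*β))).add ((hasDerivAt_id t).const_mul (g₁ a u))).add_const
      (g₂ a u * g)).add_const (g₃ a u * k)).add_const (V a u)
    refine (HasDerivAt.deriv (f := Hh u) h).trans ?_
    simp
    rw [mul_div_mul_left _ _ two_ne_zero]
  have e1 : deriv (deriv (Hh x)) m = 1/(a - x^2) := by
    rw [funext (hHm x)]
    exact (((hasDerivAt_id m).div_const _).add_const _).deriv
  have h2 : ∀ u : ℝ, HasDerivAt (fun u : ℝ => a - u^2) (-(2*u)) u := by
    intro u
    have := (((hasDerivAt_id u).pow 2).const_sub a)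
    refine this.congr_deriv ?_
    simp
  have e2 : deriv (fun u => deriv (Hh u) m) x
      = deriv (g₁ a) x - 2*x*(g₁ a x)/(a - x^2) := by
    rw [funext (fun u => hHm u m)]
    refine (((hasDerivAt_const x m).div (h2 x) hDx).add (p1 x)).deriv.trans ?_
    rw [hm]
    field_simp
    ring
  have e3 : deriv (deriv (fun u => Hh u m)) x
      = (k^2/(a-x^2) - 4*k*(g-k*x)*x/(a-x^2)^2
        + ((g-k*x)^2+m^2)*(1/(a-x^2)^2 + 4*x^2/(a-x^2)^3))
        + deriv (deriv (g₁ a)) x * m + deriv (deriv (g₂ a)) x * g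
        + deriv (deriv (g₃ a)) x * k + deriv (deriv (V a)) x := by
    have hE : deriv (fun u => Hh u m) =ᶠ[nhds x] fun u =>
        (-(k*(g-k*u))/(a-u^2) + ((g-k*u)^2+m^2)*u/(a-u^2)^2)
        + deriv (g₁ a) u * m + deriv (g₂ a) u * g
        + deriv (g₃ a) u * k + deriv (V a) u := by
      filter_upwards [hev] with u hu
      exact ((((((frac_deriv a g k (m^2) u (hD u hu)).add_const (k^2/(2*β))).add
        ((p1 u).mul_const m)).add ((q1 u).mul_const g)).add ((r1 u).mul_const k)).add (v1 u)).deriv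
    rw [hE.deriv_eq]
    exact (((((frac_deriv2 a g k (m^2) x hDx).add
        ((p2 x).mul_const m)).add ((q2 x).mul_const g)).add ((r2 x).mul_const k)).add (v2 x)).deriv
  have e4 : deriv (deriv (fun t => W β g₁ g₂ g₃ V a g k t)) x
      = (k^2/(a-x^2) - 4*k*(g-k*x)*x/(a-x^2)^2
        + ((g-k*x)^2+0)*(1/(a-x^2)^2 + 4*x^2/(a-x^2)^3))
        - ((deriv (g₁ a) x)^2 * (a-x^2) + g₁ a x * deriv (deriv (g₁ a)) x * (a-x^2)
          - 4 * x * g₁ a x * deriv (g₁ a) x - (g₁ a x)^2)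
        + deriv (deriv (g₂ a)) x * g
        + deriv (deriv (g₃ a)) x * k + deriv (deriv (V a)) x := by
    have hE : deriv (fun t => W β g₁ g₂ g₃ V a g k t) =ᶠ[nhds x] fun u =>
        (-(k*(g-k*u))/(a-u^2) + ((g-k*u)^2+0)*u/(a-u^2)^2)
        - (g₁ a u * deriv (g₁ a) u * (a-u^2) - (g₁ a u * g₁ a u) * u)
        + deriv (g₂ a) u * g
        + deriv (g₃ a) u * k + deriv (V a) u := by
      filter_upwards [hev] with u hu
      have hW : (fun t => W β g₁ g₂ g₃ V a g k t) = fun u =>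
          ((g - k*u)^2 + 0) / (2*(a - u^2)) + k^2/(2*β) - (g₁ a u * g₁ a u) * (a - u^2)/2
          + g₂ a u * g + g₃ a u * k + V a u := by
        funext t
        simp only [W]
        ring
      rw [hW]
      refine (((((((frac_deriv a g k 0 u (hD u hu)).add_const (k^2/(2*β))).sub
        ((((p1 u).mul (p1 u)).mul (h2 u)).div_const 2)).add
        ((q1 u).mul_const g)).add ((r1 u).mul_const k)).add (v1 u)).deriv).trans ?_
      simp only [Pi.mul_apply]
      ring
    rw [hE.deriv_eq]
    refine ((((((frac_deriv2 a g k 0 x hDx).sub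
        ((((p1 x).mul (p2 x)).mul (h2 x)).sub (((p1 x).mul (p1 x)).mul (hasDerivAt_id x)))).add
        ((q2 x).mul_const g)).add ((r2 x).mul_const k)).add (v2 x)).deriv).trans ?_
    simp only [Pi.mul_apply, id]
    ring
  refine ⟨e1, e2, ?_⟩
  rw [e1, e2, e3, e4, hm]
  field_simp
  ring

end
end
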